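/- arXiv:2405.07882 — 4 statements merged into one kernel-verified Lean document; each statement's English description precedes it below -/
import Mathlib

section
/- Let n ≥ 1, let A ∈ ℂ^{n×n} be invertible, let z ∈ ℂ^n, and let β ∈ ℂ with β ≠ 0 and β − z^H A z ≠ 0. Then the matrix β·A^{-1} − z·z^H is invertible and (z^H A z)/(β − z^H A z) = z^H (β·A^{-1} − z·z^H)^{-1} z. (The paper's SINR-equivalency lemma.) -/
open Matrix

/-- A rank-one perturbation `β • A⁻¹ - u vᵀ` acts on `A u` as the scalar `β - vᵀ A u`
times `u`. -/
theorem smul_inv_sub_vecMulVec_mulVec {ι K : Type*} [Fintype ι] [DecidableEq ι] [Field K]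
    {A : Matrix ι ι K} (hA : IsUnit A.det) (u v : ι → K) (β : K) :
    (β • A⁻¹ - vecMulVec u v) *ᵥ (A *ᵥ u) = (β - v ⬝ᵥ A *ᵥ u) • u := by
  rw [sub_mulVec, smul_mulVec, mulVec_mulVec, nonsing_inv_mul A hA, one_mulVec,
    vecMulVec_mulVec, op_smul_eq_smul, sub_smul]

theorem isUnit_det_smul_inv_sub_vecMulVec {ι K : Type*} [Fintype ι] [DecidableEq ι] [Field K]
    {A : Matrix ι ι K} (hA : IsUnit A.det) {u v : ι → K} {β : K} (hβ : β ≠ 0)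
    (h : β - v ⬝ᵥ A *ᵥ u ≠ 0) :
    IsUnit (β • A⁻¹ - vecMulVec u v).det := by
  rw [isUnit_iff_ne_zero]
  intro hdet
  obtain ⟨x, hx, hMx⟩ := exists_mulVec_eq_zero_iff.mpr hdet
  rw [sub_mulVec, smul_mulVec, vecMulVec_mulVec, op_smul_eq_smul, sub_eq_zero] at hMx
  have hx_eq : β • x = (v ⬝ᵥ x) • A *ᵥ u := by
    have := congrArg (A *ᵥ ·) hMx
    simpa only [mulVec_smul, mulVec_mulVec, mul_nonsing_inv A hA, one_mulVec] using this
  have hdot : v ⬝ᵥ x = 0 := by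
    have := congrArg (v ⬝ᵥ ·) hx_eq
    simp only [dotProduct_smul, smul_eq_mul] at this
    refine (mul_eq_zero.mp ?_).resolve_left h
    linear_combination this
  rw [hdot, zero_smul] at hx_eq
  exact hx ((smul_eq_zero.mp hx_eq).resolve_left hβ)

/-- **SINR-equivalency lemma** (paper's Lemma 3). For invertible `A`, `β ≠ 0` and
`β - zᴴAz ≠ 0`, the matrix `β•A⁻¹ - z zᴴ` is invertible and
`(zᴴAz)/(β - zᴴAz) = zᴴ (β•A⁻¹ - z zᴴ)⁻¹ z`. -/
theorem sinr_equivalency {n : ℕ} (hn : 1 ≤ n)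
    (A : Matrix (Fin n) (Fin n) ℂ) (hA : IsUnit A.det)
    (z : Fin n → ℂ) (β : ℂ) (hβ : β ≠ 0)
    (hβz : β - star z ⬝ᵥ A.mulVec z ≠ 0) :
    IsUnit (β • A⁻¹ - vecMulVec z (star z)).det ∧
      (star z ⬝ᵥ A.mulVec z) / (β - star z ⬝ᵥ A.mulVec z) =
        star z ⬝ᵥ (β • A⁻¹ - vecMulVec z (star z))⁻¹.mulVec z := by
  have hM := isUnit_det_smul_inv_sub_vecMulVec hA hβ hβz
  refine ⟨hM, ?_⟩
  have hAz := congrArg ((β • A⁻¹ - vecMulVec z (star z))⁻¹ *ᵥ ·)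
    (smul_inv_sub_vecMulVec_mulVec hA z (star z) β)
  simp only [mulVec_mulVec, nonsing_inv_mul_cancel_left _ _ hM, mulVec_smul] at hAz
  rw [div_eq_iff hβz]
  conv_lhs => rw [hAz]
  rw [dotProduct_smul, smul_eq_mul, mul_comm]
end

section
/- Let N_r ≥ 1, let F ∈ ℂ^{N_r×N_r} be Hermitian positive definite, let u ∈ ℂ^{N_r} be nonzero, and let c > 0 be a real number with c·(u^H F^{-1} u) < 1 (note u^H F^{-1} u is a positive real). Set g := F^{-1}·u and F₁ := F − c·u·u^H. Then: (i) F₁ is Hermitian positive definite; (ii) the instantaneous SINR of the MMSE receiver satisfies (c·|g^H u|²)/(g^H F g − c·|g^H u|²) = c·(u^H F₁^{-1} u). (Closed-form instantaneous SINR of the paper's Theorem 1, with u = Ĥ₁w₁, c = α₁²P_{d,1}, and g the MMSE combiner direction F^{-1}Ĥ₁w₁.) -/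
open Matrix ComplexOrder

namespace Matrix

variable {n : Type*} [Fintype n]

/-- For Hermitian `F`, moving `F` across the sesquilinear pairing. -/
theorem IsHermitian.star_dotProduct_mulVec {F : Matrix n n ℂ} (hF : F.IsHermitian)
    (x y : n → ℂ) : star x ⬝ᵥ F *ᵥ y = star (F *ᵥ x) ⬝ᵥ y := by
  rw [star_mulVec, hF.eq, dotProduct_mulVec]

theorem sub_smul_vecMulVec_star_mulVec (F : Matrix n n ℂ) (u x : n → ℂ) (c : ℂ) :
    (F - c • vecMulVec u (star u)) *ᵥ x = F *ᵥ x - (c * (star u ⬝ᵥ x)) • u := by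
  rw [sub_mulVec, smul_mulVec, vecMulVec_mulVec, op_smul_eq_smul, smul_smul]

/-- Completing the square in the quadratic form of the rank-one downdate `F - c • u uᴴ`,
where `F g = u`. -/
theorem IsHermitian.dotProduct_sub_smul_vecMulVec_star_mulVec {F : Matrix n n ℂ}
    (hF : F.IsHermitian) {g u : n → ℂ} (hg : F *ᵥ g = u) (c : ℝ) (x : n → ℂ) :
    star x ⬝ᵥ (F - (c : ℂ) • vecMulVec u (star u)) *ᵥ x =
      star (x - ((c : ℂ) * (star u ⬝ᵥ x)) • g) ⬝ᵥ
          F *ᵥ (x - ((c : ℂ) * (star u ⬝ᵥ x)) • g) +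
        c * (star (star u ⬝ᵥ x) * (star u ⬝ᵥ x)) * (1 - c * (star u ⬝ᵥ g)) := by
  have hx : star x ⬝ᵥ u = star (star u ⬝ᵥ x) := by
    rw [star_dotProduct]
  have hgx : star g ⬝ᵥ F *ᵥ x = star u ⬝ᵥ x := by
    rw [hF.star_dotProduct_mulVec, hg]
  have hgu : star g ⬝ᵥ u = star u ⬝ᵥ g := by
    rw [← hg, hF.star_dotProduct_mulVec]
  rw [sub_smul_vecMulVec_star_mulVec, mulVec_sub, mulVec_smul, hg, star_sub, star_smul]
  simp only [sub_dotProduct, dotProduct_sub, smul_dotProduct, dotProduct_smul, smul_eq_mul,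
    hx, hgx, hgu, star_mul', Complex.star_def, Complex.conj_ofReal]
  ring

/-- A rank-one downdate `F - c • u uᴴ` of a positive definite matrix stays positive definite
when `c * uᴴ F⁻¹ u < 1`; here `F g = u`. -/
theorem PosDef.sub_smul_vecMulVec_star {F : Matrix n n ℂ} (hF : F.PosDef) {g u : n → ℂ}
    (hg : F *ᵥ g = u) {c : ℝ} (hc : 0 < c) (hlt : (c : ℂ) * (star u ⬝ᵥ g) < 1) :
    (F - (c : ℂ) • vecMulVec u (star u)).PosDef := by
  refine .of_dotProduct_mulVec_pos (hF.isHermitian.sub ?_) fun x hx ↦ ?_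
  · rw [IsHermitian, conjTranspose_smul, conjTranspose_vecMulVec, star_star,
      Complex.star_def, Complex.conj_ofReal]
  · by_cases ht : star u ⬝ᵥ x = 0
    · rw [sub_smul_vecMulVec_star_mulVec, ht, mul_zero, zero_smul, sub_zero]
      exact hF.dotProduct_mulVec_pos hx
    · rw [hF.isHermitian.dotProduct_sub_smul_vecMulVec_star_mulVec hg]
      refine add_pos_of_nonneg_of_pos (hF.posSemidef.dotProduct_mulVec_nonneg _)
        (mul_pos (mul_pos (by exact_mod_cast hc) ?_) (sub_pos.mpr hlt))
      rw [mul_comm, Complex.star_def, Complex.mul_conj]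
      exact_mod_cast Complex.normSq_pos.mpr ht

end Matrix

/-- **Closed-form instantaneous SINR of the MMSE receiver** (paper's Theorem 1, with
`u = Ĥ₁w₁`, `c = α₁²P_{d,1}`, `g = F⁻¹u` the MMSE combiner direction and
`F₁ = F - c·u·uᴴ`): (i) `F₁` is Hermitian positive definite; (ii)
`(c·|gᴴu|²)/(gᴴFg - c·|gᴴu|²) = c·(uᴴ F₁⁻¹ u)`. -/
theorem mmse_instantaneous_sinr {Nr : ℕ} (hNr : 1 ≤ Nr)
    (F : Matrix (Fin Nr) (Fin Nr) ℂ) (hF : F.PosDef)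
    (u : Fin Nr → ℂ) (hu : u ≠ 0) (c : ℝ) (hc : 0 < c)
    (hlt : c * (star u ⬝ᵥ F⁻¹.mulVec u).re < 1) :
    (F - (c : ℂ) • vecMulVec u (star u)).PosDef ∧
      ((c : ℂ) * (Complex.normSq (star (F⁻¹.mulVec u) ⬝ᵥ u) : ℂ)) /
          (star (F⁻¹.mulVec u) ⬝ᵥ F.mulVec (F⁻¹.mulVec u) -
            (c : ℂ) * (Complex.normSq (star (F⁻¹.mulVec u) ⬝ᵥ u) : ℂ)) =
        (c : ℂ) * (star u ⬝ᵥ (F - (c : ℂ) • vecMulVec u (star u))⁻¹.mulVec u) := by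
  have hdet : IsUnit F.det := (isUnit_iff_isUnit_det F).mp hF.isUnit
  set g := F⁻¹ *ᵥ u with hgdef
  have hg : F *ᵥ g = u := by
    rw [hgdef, mulVec_mulVec, mul_nonsing_inv F hdet, one_mulVec]
  have hgu : star g ⬝ᵥ u = star u ⬝ᵥ g := by
    rw [← hg, hF.isHermitian.star_dotProduct_mulVec]
  have hpos : 0 < star u ⬝ᵥ g := hF.inv.dotProduct_mulVec_pos hu
  obtain ⟨s, hs⟩ : ∃ s : ℝ, star u ⬝ᵥ g = s :=
    ⟨_, Complex.ext rfl (Complex.pos_iff.mp hpos).2.symm⟩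
  rw [hs, Complex.ofReal_re] at hlt
  have hs0 : (s : ℂ) ≠ 0 := hs ▸ hpos.ne'
  have hcs : (1 - c * s : ℂ) ≠ 0 := by exact_mod_cast (sub_pos.mpr hlt).ne'
  have hF₁ : (F - (c : ℂ) • vecMulVec u (star u)).PosDef :=
    hF.sub_smul_vecMulVec_star hg hc (by rw [hs]; exact_mod_cast hlt)
  refine ⟨hF₁, ?_⟩
  have hF₁g : (F - (c : ℂ) • vecMulVec u (star u)) *ᵥ ((1 - c * s : ℂ)⁻¹ • g) = u := by
    rw [mulVec_smul, sub_smul_vecMulVec_star_mulVec, hg, hs]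
    nth_rewrite 1 [← one_smul ℂ u]
    rw [← sub_smul, smul_smul, inv_mul_cancel₀ hcs, one_smul]
  have hinv : (F - (c : ℂ) • vecMulVec u (star u))⁻¹ *ᵥ u = (1 - c * s : ℂ)⁻¹ • g := by
    nth_rewrite 3 [← hF₁g]
    rw [mulVec_mulVec, nonsing_inv_mul _ ((isUnit_iff_isUnit_det _).mp hF₁.isUnit), one_mulVec]
  rw [hinv, hg, hgu, dotProduct_smul, hs, Complex.normSq_ofReal, smul_eq_mul,
    Complex.ofReal_mul]
  have hden : (s - c * (s * s) : ℂ) = s * (1 - c * s) := by ring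
  rw [hden]
  field_simp
end

section
/- Let N_t, N_r ≥ 1, C ∈ ℂ^{N_t×N_t}, and let R, a matrix indexed by pairs (a,i) ∈ {1,…,N_t}×{1,…,N_r}, be Hermitian positive semidefinite. Then tr(R) is a nonnegative real and the spectral norm of the block-trace image satisfies ‖A_C(R)‖ ≤ tr(R)·‖C‖. (The operator-norm bound ‖𝒜_k(C_{ĥ_k})‖ ≤ tr(C_{ĥ_k})·‖C_{x_k}‖ from the proof of the paper's deterministic-equivalent theorem.) -/
open Matrix ComplexOrder

/-- The block-trace operator `𝒜_C` of the paper. -/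
noncomputable def blockTrace {Nt Nr : ℕ} (C : Matrix (Fin Nt) (Fin Nt) ℂ)
    (D : Matrix (Fin Nt × Fin Nr) (Fin Nt × Fin Nr) ℂ) : Matrix (Fin Nr) (Fin Nr) ℂ :=
  Matrix.of fun i j => ∑ a, ∑ b, C a b * D (a, i) (b, j)

/-- Spectral norm (largest singular value) of a complex matrix. -/
noncomputable def specNorm {m n : Type*} [Fintype m] [Fintype n] [DecidableEq n]
    (M : Matrix m n ℂ) : ℝ :=
  ‖LinearMap.toContinuousLinearMap (Matrix.toEuclideanLin M)‖

open scoped Matrix.Norms.L2Operator in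
theorem specNorm_eq_norm {m n : Type*} [Fintype m] [Fintype n] [DecidableEq n]
    (M : Matrix m n ℂ) : specNorm M = ‖M‖ := rfl

theorem specNorm_sq_le_sum_norm_sq {m n : Type*} [Fintype m] [Fintype n] [DecidableEq n]
    (M : Matrix m n ℂ) : specNorm M ^ 2 ≤ ∑ i, ∑ j, ‖M i j‖ ^ 2 := by
  have hF : 0 ≤ ∑ i, ∑ j, ‖M i j‖ ^ 2 := by positivity
  refine Real.le_sqrt (norm_nonneg _) hF |>.1 ?_
  refine ContinuousLinearMap.opNorm_le_bound _ (Real.sqrt_nonneg _) fun x => ?_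
  refine le_of_sq_le_sq ?_ (by positivity)
  rw [mul_pow, Real.sq_sqrt hF, EuclideanSpace.norm_sq_eq, EuclideanSpace.norm_sq_eq,
    Finset.sum_mul]
  refine Finset.sum_le_sum fun i _ => ?_
  refine le_trans ?_ (Finset.sum_mul_sq_le_sq_mul_sq Finset.univ (fun j => ‖M i j‖)
    fun j => ‖x j‖)
  refine pow_le_pow_left₀ (norm_nonneg _) ?_ 2
  refine (norm_sum_le Finset.univ fun j => M i j * x j).trans_eq ?_
  simp only [norm_mul]

open scoped Matrix.Norms.L2Operator in
theorem specNorm_conjTranspose_mul_mul_le {m n : Type*} [Fintype m] [Fintype n]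
    [DecidableEq m] [DecidableEq n] (V : Matrix m n ℂ) (C : Matrix m m ℂ) :
    specNorm (Vᴴ * C * V) ≤ specNorm V ^ 2 * specNorm C := by
  simp only [specNorm_eq_norm]
  calc ‖Vᴴ * C * V‖ ≤ ‖Vᴴ‖ * ‖C‖ * ‖V‖ :=
        (l2_opNorm_mul _ _).trans (by gcongr; exact l2_opNorm_mul _ _)
    _ = ‖V‖ ^ 2 * ‖C‖ := by rw [l2_opNorm_conjTranspose]; ring

theorem blockTrace_conjTranspose_mul_self {ι : Type*} [Fintype ι] {Nt Nr : ℕ}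
    (C : Matrix (Fin Nt) (Fin Nt) ℂ) (B : Matrix ι (Fin Nt × Fin Nr) ℂ) :
    blockTrace C (Bᴴ * B) =
      ∑ k, (of fun a i => B k (a, i))ᴴ * C * (of fun a i => B k (a, i)) := by
  ext i j
  simp only [blockTrace, of_apply, Matrix.sum_apply, mul_apply, conjTranspose_apply,
    Finset.mul_sum, Finset.sum_mul]
  rw [Finset.sum_comm]
  simp_rw [Finset.sum_comm (t := (Finset.univ : Finset ι))]
  exact Finset.sum_congr rfl fun _ _ => Finset.sum_congr rfl fun _ _ =>
    Finset.sum_congr rfl fun _ _ => by ring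

theorem re_trace_conjTranspose_mul_self {ι κ : Type*} [Fintype ι] [Fintype κ]
    (B : Matrix ι κ ℂ) : (Bᴴ * B).trace.re = ∑ k, ∑ p, ‖B k p‖ ^ 2 := by
  rw [Finset.sum_comm]
  simp [trace, mul_apply, ← Complex.normSq_eq_norm_sq, Complex.normSq_apply]

open scoped Matrix.Norms.L2Operator in
theorem specNorm_sum_le {ι m n : Type*} [Fintype m] [Fintype n] [DecidableEq n]
    (s : Finset ι) (M : ι → Matrix m n ℂ) :
    specNorm (∑ k ∈ s, M k) ≤ ∑ k ∈ s, specNorm (M k) :=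
  norm_sum_le s M

open scoped Matrix.Norms.L2Operator MatrixOrder in
theorem Matrix.PosSemidef.exists_eq_conjTranspose_mul_self {n : Type*} [Fintype n]
    [DecidableEq n] {R : Matrix n n ℂ} (hR : R.PosSemidef) :
    ∃ B : Matrix n n ℂ, R = Bᴴ * B :=
  CStarAlgebra.nonneg_iff_eq_star_mul_self.mp hR.nonneg

/-- **Operator-norm bound on the block-trace image** (from the proof of the paper's
deterministic-equivalent theorem): for PSD `R`, `tr(R)` is a nonnegative real and
`‖𝒜_C(R)‖ ≤ tr(R)·‖C‖`. -/
theorem blockTrace_opNorm_bound {Nt Nr : ℕ} (hNt : 1 ≤ Nt) (hNr : 1 ≤ Nr)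
    (C : Matrix (Fin Nt) (Fin Nt) ℂ)
    (R : Matrix (Fin Nt × Fin Nr) (Fin Nt × Fin Nr) ℂ) (hR : R.PosSemidef) :
    0 ≤ R.trace.re ∧ R.trace.im = 0 ∧
      specNorm (blockTrace C R) ≤ R.trace.re * specNorm C := by
  have htr := Complex.nonneg_iff.1 hR.trace_nonneg
  refine ⟨htr.1, htr.2.symm, ?_⟩
  obtain ⟨B, rfl⟩ := hR.exists_eq_conjTranspose_mul_self
  rw [blockTrace_conjTranspose_mul_self, re_trace_conjTranspose_mul_self, Finset.sum_mul]
  refine (specNorm_sum_le _ _).trans (Finset.sum_le_sum fun k _ => ?_)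
  refine (specNorm_conjTranspose_mul_mul_le _ _).trans ?_
  refine mul_le_mul_of_nonneg_right ?_ (norm_nonneg _)
  refine (specNorm_sq_le_sum_norm_sq _).trans_eq ?_
  simp only [Fintype.sum_prod_type, of_apply]
end

section
/- Let κ, c, a, b ∈ ℝ and let w ∈ ℂ be any complex number with w² = κ² − c² + 2·𝕚·κ·c·cos(a−b). Then (1/(2π))·∫_{−π}^{π} exp(κ·cos(φ−b) + 𝕚·c·cos(φ−a)) dφ = I₀(w); the value I₀(w) does not depend on the choice of square root w because I₀ is an even function. (The trigonometric integral identity from which the paper derives the von Mises correlation formulas of its first Corollary.) -/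
open Real intervalIntegral

/-- The paper's zeroth-order modified Bessel function of the first kind:
`I₀(z) = (1/π)·∫₀^π exp(z·cos t) dt`. -/
noncomputable def besselI0 (z : ℂ) : ℂ :=
  (1 / (Real.pi : ℂ)) * ∫ t in (0 : ℝ)..Real.pi, Complex.exp (z * (Real.cos t : ℂ))

/-- The circle averages about the origin of a function holomorphic on the punctured plane do not
depend on the radius. -/
theorem circleAverage_eq_of_differentiableAt_ne_zero {f : ℂ → ℂ}
    (hf : ∀ z ≠ 0, DifferentiableAt ℂ f z) {r R : ℝ} (hr : 0 < r) (hR : 0 < R) :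
    circleAverage f 0 r = circleAverage f 0 R := by
  wlog hle : r ≤ R generalizing r R
  · exact (this hR hr (le_of_not_ge hle)).symm
  rw [circleAverage_eq_circleIntegral hr.ne', circleAverage_eq_circleIntegral hR.ne',
    Complex.circleIntegral_sub_center_inv_smul_eq_of_differentiable_on_annulus_off_countable
      hr hle Set.countable_empty]
  · rintro z ⟨-, hz⟩
    refine (hf z ?_).continuousAt.continuousWithinAt
    rintro rfl
    exact hz (Metric.mem_ball_self hr)
  · rintro z ⟨⟨-, hz⟩, -⟩
    refine hf z ?_
    rintro rfl
    exact hz (Metric.mem_closedBall_self hr.le)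

/-- The circle average of a function holomorphic on the punctured plane is invariant under
multiplication of the variable by a nonzero complex number. -/
theorem circleAverage_comp_const_mul {f : ℂ → ℂ} (hf : ∀ z ≠ 0, DifferentiableAt ℂ f z)
    {u : ℂ} (hu : u ≠ 0) :
    circleAverage (fun z ↦ f (u * z)) 0 1 = circleAverage f 0 1 := by
  rw [← circleAverage_eq_of_differentiableAt_ne_zero hf (norm_pos_iff.2 hu) one_pos,
    circleAverage_eq_integral_add (f := f) u.arg, circleAverage_def]
  congr 2
  ext θ
  congr 1
  conv_lhs => rw [← Complex.norm_mul_exp_arg_mul_I u]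
  simp only [circleMap, zero_add, Complex.ofReal_one, one_mul, Complex.ofReal_add, add_mul,
    Complex.exp_add]
  ring

theorem circleAverage_exp_const_mul (B : ℂ) :
    circleAverage (fun z ↦ Complex.exp (B * z)) 0 1 = 1 := by
  have hd : Differentiable ℂ fun z : ℂ ↦ Complex.exp (B * z) := by fun_prop
  have h := (hd.diffContOnCl (s := Metric.ball 0 |1|)).circleAverage
  simpa using h

/-- The circle average of `exp (A z + B / z)` depends only on the product `A * B`. -/
theorem circleAverage_exp_add_inv {A B s : ℂ} (hs : s ^ 2 = A * B) :
    circleAverage (fun z ↦ Complex.exp (A * z + B * z⁻¹)) 0 1 =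
      circleAverage (fun z ↦ Complex.exp (s * z + s * z⁻¹)) 0 1 := by
  by_cases h0 : s = 0
  · subst h0
    have hs' : A = 0 ∨ B = 0 := by simpa [eq_comm] using hs
    have h1 : circleAverage (fun _ ↦ (1 : ℂ)) 0 1 = 1 := circleAverage_const _ _ _
    rcases hs' with rfl | rfl
    · have h := circleAverage_zero_one_congr_inv (f := fun z ↦ Complex.exp (B * z))
      simpa [h1] using h.trans (circleAverage_exp_const_mul B)
    · simpa [h1] using circleAverage_exp_const_mul A
  · have hA : A ≠ 0 := by
      rintro rfl
      simp_all
    rw [← circleAverage_comp_const_mul (u := s / A) _ (div_ne_zero h0 hA)]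
    · congr 1
      ext z
      have h1 : A * (s / A * z) = s * z := by field_simp
      have h2 : B * (s / A * z)⁻¹ = s * z⁻¹ := by
        rw [mul_inv, inv_div, ← mul_assoc]
        congr 1
        field_simp
        linear_combination -hs
      rw [h1, h2]
    · intro z hz
      fun_prop (disch := assumption)

theorem circleAverage_zero_one_eq_integral_neg_pi_pi (f : ℂ → ℂ) :
    circleAverage f 0 1 =
      (1 / (2 * (π : ℂ))) * ∫ φ in (-π)..π, f (Complex.exp (φ * Complex.I)) := by
  have h := (((periodic_circleMap 0 1).comp f).intervalIntegral_add_eq (-π) 0)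
  rw [show -π + 2 * π = π by ring, zero_add] at h
  have h' : ∫ φ in (-π)..π, f (Complex.exp (φ * Complex.I)) =
      ∫ φ in (-π)..π, (f ∘ circleMap 0 1) φ := by
    simp [circleMap]
  rw [h', h, circleAverage_def, Complex.real_smul]
  simp

theorem besselI0_eq_circleAverage (w : ℂ) :
    besselI0 w = circleAverage (fun z ↦ Complex.exp (w / 2 * z + w / 2 * z⁻¹)) 0 1 := by
  have h : ∀ t : ℝ, Complex.exp (w / 2 * Complex.exp (t * Complex.I) +
      w / 2 * (Complex.exp (t * Complex.I))⁻¹) = Complex.exp (w * (Real.cos t : ℂ)) := by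
    intro t
    rw [Complex.ofReal_cos, Complex.cos, ← Complex.exp_neg, neg_mul]
    ring_nf
  have hi : ∀ a b : ℝ, IntervalIntegrable (fun t : ℝ ↦ Complex.exp (w * (Real.cos t : ℂ)))
      MeasureTheory.volume a b := fun a b ↦
    Continuous.intervalIntegrable (by fun_prop) a b
  have hneg := integral_comp_neg (a := 0) (b := π)
    (fun t : ℝ ↦ Complex.exp (w * (Real.cos t : ℂ)))
  simp only [Real.cos_neg, neg_zero] at hneg
  rw [circleAverage_zero_one_eq_integral_neg_pi_pi]
  simp only [h]
  rw [← integral_add_adjacent_intervals (hi (-π) 0) (hi 0 π), ← hneg, besselI0]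
  ring

theorem besselI0_eq_circleAverage_of_sq_eq {A B w : ℂ} (hw : w ^ 2 = 4 * (A * B)) :
    besselI0 w = circleAverage (fun z ↦ Complex.exp (A * z + B * z⁻¹)) 0 1 := by
  rw [besselI0_eq_circleAverage, circleAverage_exp_add_inv (A := A) (B := B) (s := w / 2)]
  linear_combination hw / 4

/-- **Trigonometric integral identity** from which the paper derives the von Mises
correlation formulas: for any `w` with `w² = κ² − c² + 2𝕚κc·cos(a−b)`,
`(1/2π)·∫_{-π}^{π} exp(κ·cos(φ−b) + 𝕚·c·cos(φ−a)) dφ = I₀(w)`; the value does not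
depend on the choice of square root since `I₀` is even. -/
theorem von_mises_integral (κ c a b : ℝ) (w : ℂ)
    (hw : w ^ 2 = (κ : ℂ) ^ 2 - (c : ℂ) ^ 2 +
        2 * Complex.I * (κ : ℂ) * (c : ℂ) * (Real.cos (a - b) : ℂ)) :
    ((1 / (2 * (Real.pi : ℂ))) *
        ∫ φ in (-Real.pi)..Real.pi,
          Complex.exp ((κ : ℂ) * (Real.cos (φ - b) : ℂ) +
            Complex.I * (c : ℂ) * (Real.cos (φ - a) : ℂ)) = besselI0 w) ∧
      (∀ z : ℂ, besselI0 (-z) = besselI0 z) := by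
  constructor
  · have hexp (x y : ℝ) : (Real.cos (x - y) : ℂ) =
        (Complex.exp (-(y * Complex.I)) * Complex.exp (x * Complex.I) +
          Complex.exp (y * Complex.I) * (Complex.exp (x * Complex.I))⁻¹) / 2 := by
      rw [Complex.ofReal_cos, Complex.cos, ← Complex.exp_neg, ← Complex.exp_add,
        ← Complex.exp_add]
      push_cast
      ring_nf
    have hinv (x : ℝ) : Complex.exp (x * Complex.I) * Complex.exp (-(x * Complex.I)) = 1 := by
      rw [← Complex.exp_add, add_neg_cancel, Complex.exp_zero]
    rw [besselI0_eq_circleAverage_of_sq_eq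
        (A := (κ * Complex.exp (-(b * Complex.I)) +
          Complex.I * c * Complex.exp (-(a * Complex.I))) / 2)
        (B := (κ * Complex.exp (b * Complex.I) +
          Complex.I * c * Complex.exp (a * Complex.I)) / 2),
      circleAverage_zero_one_eq_integral_neg_pi_pi]
    · congr 2
      ext φ
      rw [hexp, hexp]
      ring_nf
    · rw [hw, hexp, ← Complex.exp_neg]
      linear_combination (-(κ : ℂ) ^ 2) * hinv b + (c : ℂ) ^ 2 * hinv a -
        (c : ℂ) ^ 2 * Complex.exp (a * Complex.I) * Complex.exp (-(a * Complex.I)) *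
          Complex.I_sq
  · intro z
    rw [besselI0_eq_circleAverage z]
    apply besselI0_eq_circleAverage_of_sq_eq
    ring
end
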